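/- Reduction of the surrogate to an LQPQM (Theorem 1, part 2): for every q ∈ ℂ^{M−1}, ℓ2(u*(q), q) = (q + A^{-1}b)^H A (q + A^{-1}b) − log((q − C^{-1}g)^H C (q − C^{-1}g) + z) + κ, where u*(q) = V_k^{-1} q̃ / sqrt(q̃^H V_k^{-1} q̃) with q̃ = e_k − Ē_k q*, and the constant κ = 1 − b^H A^{-1} b + Σ_{m≠k} (V_m)_{mm} does not depend on q. Consequently, q minimizes q ↦ ℓ2(u*(q), q) if and only if q solves this instance of log-quadratically penalized quadratic minimization. -/

import Mathlib

open Matrix ComplexOrder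

/-- `Ebar k` is the `M × (M-1)` matrix whose columns are all canonical basis vectors
of `ℂ^M` except the `k`-th one. -/
noncomputable def Ebar {M : ℕ} (k : Fin M) : Matrix (Fin M) {m : Fin M // m ≠ k} ℂ :=
  Matrix.of fun i j => if i = (j : Fin M) then 1 else 0

/-- The IPA update matrix `T_k(u, q) = I + e_k (u - e_k)^H + Ē_k q* e_kᵀ`. -/
noncomputable def Tk {M : ℕ} (k : Fin M) (u : Fin M → ℂ) (q : {m : Fin M // m ≠ k} → ℂ) :
    Matrix (Fin M) (Fin M) ℂ :=
  1 + vecMulVec (Pi.single k 1) (star (u - Pi.single k 1))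
    + vecMulVec (Ebar k *ᵥ star q) (Pi.single k 1)

/-- The surrogate cost
`ℓ2(u, q) = Σ_{m≠k} (e_m + q_m e_k)^H V_m (e_m + q_m e_k) + u^H V_k u - 2 log |det T_k(u, q)|`. -/
noncomputable def ell2 {M : ℕ} (k : Fin M) (V : Fin M → Matrix (Fin M) (Fin M) ℂ)
    (u : Fin M → ℂ) (q : {m : Fin M // m ≠ k} → ℂ) : ℝ :=
  (∑ m : {m : Fin M // m ≠ k},
      (star ((Pi.single (m : Fin M) 1 : Fin M → ℂ) + q m • (Pi.single k 1 : Fin M → ℂ)) ⬝ᵥ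
        (V m *ᵥ ((Pi.single (m : Fin M) 1 : Fin M → ℂ) + q m • (Pi.single k 1 : Fin M → ℂ)))).re)
    + (star u ⬝ᵥ (V k *ᵥ u)).re
    - 2 * Real.log ‖(Tk k u q).det‖

/-- The modified target vector `q̃ = e_k - Ē_k q*`. -/
noncomputable def qtilde {M : ℕ} (k : Fin M) (q : {m : Fin M // m ≠ k} → ℂ) : Fin M → ℂ :=
  Pi.single k 1 - Ebar k *ᵥ star q

/-- The optimal demixing filter `u*(q) = V_k⁻¹ q̃ / sqrt(q̃^H V_k⁻¹ q̃)`. -/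
noncomputable def ustar {M : ℕ} (k : Fin M) (V : Fin M → Matrix (Fin M) (Fin M) ℂ)
    (q : {m : Fin M // m ≠ k} → ℂ) : Fin M → ℂ :=
  ((Real.sqrt ((star (qtilde k q) ⬝ᵥ ((V k)⁻¹ *ᵥ qtilde k q)).re) : ℂ))⁻¹ •
    ((V k)⁻¹ *ᵥ qtilde k q)

/-- The matrix `A = diag((V_m)_{kk})_{m≠k}`. -/
noncomputable def matA {M : ℕ} (k : Fin M) (V : Fin M → Matrix (Fin M) (Fin M) ℂ) :
    Matrix {m : Fin M // m ≠ k} {m : Fin M // m ≠ k} ℂ :=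
  Matrix.diagonal fun m => V (m : Fin M) k k

/-- The vector `b` with entries `b_m = (V_m)_{km}`, `m ≠ k`. -/
noncomputable def vecb {M : ℕ} (k : Fin M) (V : Fin M → Matrix (Fin M) (Fin M) ℂ) :
    {m : Fin M // m ≠ k} → ℂ :=
  fun m => V (m : Fin M) k (m : Fin M)

/-- The matrix `C = Ē_kᵀ (V_k⁻¹)* Ē_k`. -/
noncomputable def matC {M : ℕ} (k : Fin M) (V : Fin M → Matrix (Fin M) (Fin M) ℂ) :
    Matrix {m : Fin M // m ≠ k} {m : Fin M // m ≠ k} ℂ :=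
  (Ebar k)ᵀ * ((V k)⁻¹.map (starRingEnd ℂ)) * Ebar k

/-- The vector `g = Ē_kᵀ (V_k⁻¹)* e_k`. -/
noncomputable def vecg {M : ℕ} (k : Fin M) (V : Fin M → Matrix (Fin M) (Fin M) ℂ) :
    {m : Fin M // m ≠ k} → ℂ :=
  (Ebar k)ᵀ *ᵥ (((V k)⁻¹.map (starRingEnd ℂ)) *ᵥ (Pi.single k 1 : Fin M → ℂ))

/-- The scalar `z = e_kᵀ (V_k⁻¹)* e_k - g^H C⁻¹ g` (a real number). -/
noncomputable def scalz {M : ℕ} (k : Fin M) (V : Fin M → Matrix (Fin M) (Fin M) ℂ) : ℝ :=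
  ((Pi.single k 1 : Fin M → ℂ) ⬝ᵥ
      (((V k)⁻¹.map (starRingEnd ℂ)) *ᵥ (Pi.single k 1 : Fin M → ℂ))
    - star (vecg k V) ⬝ᵥ ((matC k V)⁻¹ *ᵥ vecg k V)).re

/-- The LQPQM objective obtained after eliminating `u`:
`R(q) = (q + A⁻¹b)^H A (q + A⁻¹b) - log((q - C⁻¹g)^H C (q - C⁻¹g) + z)`. -/
noncomputable def lqpqmObj {M : ℕ} (k : Fin M) (V : Fin M → Matrix (Fin M) (Fin M) ℂ)
    (q : {m : Fin M // m ≠ k} → ℂ) : ℝ :=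
  (star (q + (matA k V)⁻¹ *ᵥ vecb k V) ⬝ᵥ (matA k V *ᵥ (q + (matA k V)⁻¹ *ᵥ vecb k V))).re
    - Real.log
        ((star (q - (matC k V)⁻¹ *ᵥ vecg k V) ⬝ᵥ
            (matC k V *ᵥ (q - (matC k V)⁻¹ *ᵥ vecg k V))).re + scalz k V)

section HermitianForms

theorem Matrix.PosDef.map_conj {n : Type*} {N : Matrix n n ℂ} (hN : N.PosDef) :
    (N.map (starRingEnd ℂ)).PosDef := by
  have h : N.map (starRingEnd ℂ) = Nᵀ := by
    conv_rhs => rw [← hN.isHermitian.eq]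
    rfl
  exact h ▸ hN.transpose

variable {n m : Type*} [Fintype n] [Fintype m]

/-- Completing the square for a nonsingular Hermitian matrix. -/
theorem Matrix.IsHermitian.star_add_inv_mulVec_dotProduct [DecidableEq n]
    {B : Matrix n n ℂ} (hB : B.IsHermitian) (hdet : IsUnit B.det) (x c : n → ℂ) :
    star (x + B⁻¹ *ᵥ c) ⬝ᵥ (B *ᵥ (x + B⁻¹ *ᵥ c)) =
      star x ⬝ᵥ (B *ᵥ x) + star x ⬝ᵥ c + star c ⬝ᵥ x + star c ⬝ᵥ (B⁻¹ *ᵥ c) := by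
  have hinv : B⁻¹ᴴ = B⁻¹ := hB.inv
  rw [mulVec_add, mulVec_mulVec, mul_nonsing_inv _ hdet, one_mulVec, star_add, star_mulVec, hinv,
    add_dotProduct, dotProduct_add, dotProduct_add, ← dotProduct_mulVec, ← dotProduct_mulVec,
    mulVec_mulVec, nonsing_inv_mul _ hdet, one_mulVec]
  ring

theorem dotProduct_mulVec_transpose (N : Matrix n m ℂ) (x : n → ℂ) (y : m → ℂ) :
    x ⬝ᵥ (N *ᵥ y) = y ⬝ᵥ (Nᵀ *ᵥ x) := by
  rw [dotProduct_mulVec, dotProduct_comm, mulVec_transpose]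

theorem Matrix.det_one_add_vecMulVec [DecidableEq n] (u v : n → ℂ) :
    (1 + vecMulVec u v).det = 1 + v ⬝ᵥ u := by
  rw [vecMulVec_eq Unit, det_one_add_replicateCol_mul_replicateRow]

end HermitianForms

section Surrogate

variable {M : ℕ} (k : Fin M)

theorem Ebar_mulVec_self (x : {m : Fin M // m ≠ k} → ℂ) : (Ebar k *ᵥ x) k = 0 := by
  simp only [mulVec, dotProduct, Ebar, of_apply]
  exact Finset.sum_eq_zero fun j _ => by simp [j.2.symm]

theorem Ebar_mulVec_coe (x : {m : Fin M // m ≠ k} → ℂ) (j : {m : Fin M // m ≠ k}) :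
    (Ebar k *ᵥ x) j = x j := by
  simp [mulVec, dotProduct, Ebar, Subtype.coe_inj]

theorem Ebar_mulVec_injective : Function.Injective (Ebar k).mulVec := fun x y h => by
  ext j
  rw [← Ebar_mulVec_coe k x j, h, Ebar_mulVec_coe]

theorem conjTranspose_Ebar : (Ebar k)ᴴ = (Ebar k)ᵀ := by
  ext i j
  simp [Ebar, apply_ite]

theorem star_Ebar_mulVec (x : {m : Fin M // m ≠ k} → ℂ) :
    star (Ebar k *ᵥ x) = Ebar k *ᵥ star x := by
  rw [star_mulVec, conjTranspose_Ebar, vecMul_transpose]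

theorem star_qtilde (q : {m : Fin M // m ≠ k} → ℂ) :
    star (qtilde k q) = Pi.single k 1 - Ebar k *ᵥ q := by
  rw [qtilde, star_sub, star_Ebar_mulVec, star_star, Pi.star_single, star_one]

theorem qtilde_self (q : {m : Fin M // m ≠ k} → ℂ) : qtilde k q k = 1 := by
  simp [qtilde, Ebar_mulVec_self]

theorem qtilde_ne_zero (q : {m : Fin M // m ≠ k} → ℂ) : qtilde k q ≠ 0 := fun h => by
  simpa [h] using qtilde_self k q

theorem det_Tk (u : Fin M → ℂ) (q : {m : Fin M // m ≠ k} → ℂ) :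
    (Tk k u q).det = star u ⬝ᵥ qtilde k q := by
  set e : Fin M → ℂ := Pi.single k 1 with he
  set w := Ebar k *ᵥ star q with hw
  have hew : e ⬝ᵥ w = 0 := by simp [he, hw, Ebar_mulVec_self]
  have hX : (1 + vecMulVec (-w) e).det = 1 := by
    rw [det_one_add_vecMulVec, dotProduct_neg, hew, neg_zero, add_zero]
  have hmul : Tk k u q * (1 + vecMulVec (-w) e) =
      1 + vecMulVec e (star (u - e) ᵥ* (1 + vecMulVec (-w) e)) := by
    have h0 : vecMulVec w e * vecMulVec (-w) e = 0 := by
      rw [vecMulVec_mul_vecMulVec, dotProduct_neg, hew]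
      ext
      simp [vecMulVec_apply]
    rw [Tk, ← he, ← hw, add_mul, add_mul, mul_add (vecMulVec w e), h0, vecMulVec_mul, neg_vecMulVec]
    simp only [mul_one, one_mul, add_zero]
    abel
  have hXe : (1 + vecMulVec (-w) e) *ᵥ e = qtilde k q := by
    rw [add_mulVec, one_mulVec, vecMulVec_mulVec, qtilde, ← he, ← hw]
    ext i
    simp [he, sub_eq_add_neg]
  have hstar : star e = e := by rw [he, Pi.star_single, star_one]
  have heq : e ⬝ᵥ qtilde k q = 1 := by simp [he, qtilde_self]
  rw [← mul_one (Tk k u q).det, ← hX, ← det_mul, hmul, det_one_add_vecMulVec, ← dotProduct_mulVec,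
    hXe, star_sub, sub_dotProduct, hstar, heq]
  ring

variable (V : Fin M → Matrix (Fin M) (Fin M) ℂ)

theorem posDef_matC (hV : (V k).PosDef) : (matC k V).PosDef := by
  rw [matC, ← conjTranspose_Ebar]
  exact hV.inv.map_conj.conjTranspose_mul_mul_same (Ebar_mulVec_injective k)

theorem posDef_matA (hV : ∀ m, (V m).PosDef) : (matA k V).PosDef :=
  PosDef.diagonal fun m => (hV m).diag_pos

theorem star_qtilde_dotProduct_inv_mulVec (hV : (V k).PosDef) (q : {m : Fin M // m ≠ k} → ℂ) :
    (star (qtilde k q) ⬝ᵥ ((V k)⁻¹ *ᵥ qtilde k q)).re =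
      (star (q - (matC k V)⁻¹ *ᵥ vecg k V) ⬝ᵥ
        (matC k V *ᵥ (q - (matC k V)⁻¹ *ᵥ vecg k V))).re + scalz k V := by
  have hC := posDef_matC k V hV
  have hsq := hC.isHermitian.star_add_inv_mulVec_dotProduct
    ((isUnit_iff_isUnit_det _).1 hC.isUnit) q (-vecg k V)
  simp only [mulVec_neg, ← sub_eq_add_neg, star_neg, neg_dotProduct, dotProduct_neg, neg_neg] at hsq
  set W := (V k)⁻¹.map (starRingEnd ℂ) with hW
  have hWH : Wᴴ = W := hV.inv.map_conj.isHermitian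
  have hWT : (V k)⁻¹ᵀ = W := by
    conv_lhs => rw [← hV.inv.isHermitian.eq]
    rfl
  set e : Fin M → ℂ := Pi.single k 1 with he
  have hstar : star e = e := by rw [he, Pi.star_single, star_one]
  have h1 : star q ⬝ᵥ vecg k V = star (Ebar k *ᵥ q) ⬝ᵥ (W *ᵥ e) := by
    rw [vecg, ← hW, ← he, dotProduct_mulVec, vecMul_transpose, star_Ebar_mulVec]
  have h2 : star (vecg k V) ⬝ᵥ q = e ⬝ᵥ (W *ᵥ (Ebar k *ᵥ q)) := by
    rw [vecg, ← hW, ← he, star_mulVec, ← conjTranspose_Ebar, conjTranspose_conjTranspose,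
      ← dotProduct_mulVec, star_mulVec, hWH, hstar, ← dotProduct_mulVec]
  have h3 : star q ⬝ᵥ (matC k V *ᵥ q) = star (Ebar k *ᵥ q) ⬝ᵥ (W *ᵥ (Ebar k *ᵥ q)) := by
    rw [matC, ← hW, ← mulVec_mulVec, ← mulVec_mulVec, dotProduct_mulVec, vecMul_transpose,
      star_Ebar_mulVec]
  rw [hsq, scalz, ← hW, ← he, ← Complex.add_re, h1, h2, h3, dotProduct_mulVec_transpose, hWT,
    ← star_star (qtilde k q), star_star (star _), star_qtilde, ← he, star_sub, hstar, mulVec_sub,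
    sub_dotProduct, dotProduct_sub, dotProduct_sub]
  congr 1
  ring

theorem ustar_cost (hV : (V k).PosDef) (q : {m : Fin M // m ≠ k} → ℂ) :
    (star (ustar k V q) ⬝ᵥ (V k *ᵥ ustar k V q)).re - 2 * Real.log ‖(Tk k (ustar k V q) q).det‖ =
      1 - Real.log (star (qtilde k q) ⬝ᵥ ((V k)⁻¹ *ᵥ qtilde k q)).re := by
  have hdet := (isUnit_iff_isUnit_det _).1 hV.isUnit
  have hinv : (V k)⁻¹ᴴ = (V k)⁻¹ := hV.inv.isHermitian
  have hpos := hV.inv.dotProduct_mulVec_pos (qtilde_ne_zero k q)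
  rw [det_Tk, ustar]
  obtain ⟨hre, him⟩ := Complex.pos_iff.1 hpos
  set r := (star (qtilde k q) ⬝ᵥ ((V k)⁻¹ *ᵥ qtilde k q)).re with hr
  have hs : star (qtilde k q) ⬝ᵥ ((V k)⁻¹ *ᵥ qtilde k q) = (r : ℂ) :=
    Complex.ext rfl him.symm
  have hsqrt : (Real.sqrt r : ℂ) * Real.sqrt r = r := by
    rw [← Complex.ofReal_mul, Real.mul_self_sqrt hre.le]
  have hne : (Real.sqrt r : ℂ) ≠ 0 := Complex.ofReal_ne_zero.2 (Real.sqrt_pos.2 hre).ne'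
  have hstar : star (((Real.sqrt r : ℂ))⁻¹) = ((Real.sqrt r : ℂ))⁻¹ := by simp
  have h1 : star ((V k)⁻¹ *ᵥ qtilde k q) ⬝ᵥ qtilde k q = r := by
    rw [star_mulVec, hinv, ← dotProduct_mulVec, hs]
  have h2 : (Real.sqrt r : ℂ)⁻¹ * r = Real.sqrt r := by
    rw [← hsqrt, inv_mul_cancel_left₀ hne]
  rw [star_smul, hstar, mulVec_smul, mulVec_mulVec, mul_nonsing_inv _ hdet, one_mulVec,
    smul_dotProduct, dotProduct_smul, smul_dotProduct, h1, smul_eq_mul, smul_eq_mul, h2,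
    inv_mul_cancel₀ hne, Complex.norm_real, Real.norm_of_nonneg (Real.sqrt_nonneg r),
    Real.log_sqrt hre.le, Complex.one_re]
  ring

theorem sum_cost (hV : ∀ m, (V m).PosDef) (q : {m : Fin M // m ≠ k} → ℂ) :
    (∑ m : {m : Fin M // m ≠ k},
      (star ((Pi.single (m : Fin M) 1 : Fin M → ℂ) + q m • (Pi.single k 1 : Fin M → ℂ)) ⬝ᵥ
        (V m *ᵥ ((Pi.single (m : Fin M) 1 : Fin M → ℂ) + q m • (Pi.single k 1 : Fin M → ℂ)))).re) =
    (star (q + (matA k V)⁻¹ *ᵥ vecb k V) ⬝ᵥ (matA k V *ᵥ (q + (matA k V)⁻¹ *ᵥ vecb k V))).re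
      - (star (vecb k V) ⬝ᵥ ((matA k V)⁻¹ *ᵥ vecb k V)).re
      + ∑ m : {m : Fin M // m ≠ k}, (V (m : Fin M) (m : Fin M) (m : Fin M)).re := by
  have hA := posDef_matA k V hV
  have hterm : ∀ m : {m : Fin M // m ≠ k},
      star ((Pi.single (m : Fin M) 1 : Fin M → ℂ) + q m • (Pi.single k 1 : Fin M → ℂ)) ⬝ᵥ
        (V m *ᵥ ((Pi.single (m : Fin M) 1 : Fin M → ℂ) + q m • (Pi.single k 1 : Fin M → ℂ))) =
      star (q m) * (V m k k * q m) + star (q m) * V m k m + star (V m k m) * q m + V m m m := by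
    intro m
    have hconj : star (V m k m) = V m m k := (hV m).isHermitian.apply _ _
    simp only [star_add, star_smul, Pi.star_single, star_one, mulVec_add, mulVec_smul,
      mulVec_single_one, add_dotProduct, dotProduct_add, smul_dotProduct, dotProduct_smul,
      single_one_dotProduct, col_apply, smul_eq_mul, hconj]
    ring
  rw [hA.isHermitian.star_add_inv_mulVec_dotProduct ((isUnit_iff_isUnit_det _).1 hA.isUnit),
    Complex.add_re, add_sub_cancel_right]
  simp only [hterm]
  simp only [dotProduct, matA, mulVec_diagonal, vecb, Pi.star_apply,
    ← Finset.sum_add_distrib, Complex.re_sum, Complex.add_re]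

end Surrogate

/-- Theorem 1, part 2: the surrogate evaluated at the optimal filter `u*(q)` equals an
LQPQM objective up to a constant `κ = 1 - b^H A⁻¹ b + Σ_{m≠k} (V_m)_{mm}` independent of
`q`; consequently, `q` minimizes `q ↦ ℓ2(u*(q), q)` if and only if `q` solves this
instance of LQPQM. -/
theorem surrogate_reduces_to_lqpqm {M : ℕ} (hM : 2 ≤ M) (k : Fin M)
    (V : Fin M → Matrix (Fin M) (Fin M) ℂ) (hV : ∀ m, (V m).PosDef) :
    letI κ : ℝ := 1 - (star (vecb k V) ⬝ᵥ ((matA k V)⁻¹ *ᵥ vecb k V)).re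
      + ∑ m : {m : Fin M // m ≠ k}, (V (m : Fin M) (m : Fin M) (m : Fin M)).re
    (∀ q : {m : Fin M // m ≠ k} → ℂ,
        ell2 k V (ustar k V q) q = lqpqmObj k V q + κ) ∧
    (∀ q : {m : Fin M // m ≠ k} → ℂ,
        (∀ q' : {m : Fin M // m ≠ k} → ℂ, ell2 k V (ustar k V q) q ≤ ell2 k V (ustar k V q') q')
          ↔ (∀ q' : {m : Fin M // m ≠ k} → ℂ, lqpqmObj k V q ≤ lqpqmObj k V q')) := by
  have key : ∀ q : {m : Fin M // m ≠ k} → ℂ, ell2 k V (ustar k V q) q = lqpqmObj k V q +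
      (1 - (star (vecb k V) ⬝ᵥ ((matA k V)⁻¹ *ᵥ vecb k V)).re
        + ∑ m : {m : Fin M // m ≠ k}, (V (m : Fin M) (m : Fin M) (m : Fin M)).re) := fun q => by
    rw [ell2, add_sub_assoc, ustar_cost k V (hV k), sum_cost k V hV,
      star_qtilde_dotProduct_inv_mulVec k V (hV k), lqpqmObj]
    ring
  exact ⟨key, fun q => by simp only [key, add_le_add_iff_right]⟩
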